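/- arXiv:2204.09312 — 7 statements merged into one kernel-verified Lean document; each statement's English description precedes it below -/
import Mathlib

section
/- Let n ≥ 5 and let u : ZMod n → ℤ² be the ray data of a complete smooth fan in ℝ² (each u_i primitive, det(u_i, u_{i+1}) = 1 for all i, the cones Cone(u_i, u_{i+1}) cover ℝ², and distinct such cones have disjoint interiors), and set γ_i = det(u_{i-1}, u_{i+1}). Let Δ ⊆ ZMod n be nonempty and define a_i = 0 if i ∈ Δ and a_i = 1 otherwise. Then there exists i ∈ ZMod n such that a_{i-1} + a_{i+1} - γ_i · a_i ≤ 0. (Equivalently, via the toric Kleiman criterion, for a complete smooth toric surface X of Picard rank at least 3 and any nonzero reduced torus-invariant divisor D, the divisor -(K_X + D) is not ample, i.e., the pair (X, D) is not toric log del Pezzo.) -/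
/-- `det(u, v) = u₁v₂ - u₂v₁` for `u, v ∈ ℤ²`. -/
def det2 (u v : ℤ × ℤ) : ℤ := u.1 * v.2 - u.2 * v.1

/-- The embedding `ℤ² → ℝ²`. -/
noncomputable def toR2 (u : ℤ × ℤ) : ℝ × ℝ := ((u.1 : ℝ), (u.2 : ℝ))

/-- The cone `Cone(u, v) = {s·u + t·v : s, t ≥ 0} ⊆ ℝ²` spanned by `u, v ∈ ℤ²`. -/
def coneR (u v : ℤ × ℤ) : Set (ℝ × ℝ) :=
  {x | ∃ s t : ℝ, 0 ≤ s ∧ 0 ≤ t ∧ x = s • toR2 u + t • toR2 v}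

/-- The interior `{s·u + t·v : s, t > 0}` of the cone spanned by `u, v ∈ ℤ²`. -/
def coneIntR (u v : ℤ × ℤ) : Set (ℝ × ℝ) :=
  {x | ∃ s t : ℝ, 0 < s ∧ 0 < t ∧ x = s • toR2 u + t • toR2 v}

/-- `u : ZMod n → ℤ²` is the ray data of a complete smooth fan in `ℝ²`:
each `u i` is primitive, `det(u i, u (i+1)) = 1`, the cones `Cone(u i, u (i+1))`
cover `ℝ²`, and distinct such cones have disjoint interiors. -/
structure IsCompleteSmoothFan {n : ℕ} (u : ZMod n → ℤ × ℤ) : Prop where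
  primitive : ∀ i, Int.gcd (u i).1 (u i).2 = 1
  det_succ : ∀ i, det2 (u i) (u (i + 1)) = 1
  covers : ∀ x : ℝ × ℝ, ∃ i, x ∈ coneR (u i) (u (i + 1))
  disjoint_interiors : ∀ i j, i ≠ j →
    coneIntR (u i) (u (i + 1)) ∩ coneIntR (u j) (u (j + 1)) = ∅

theorem mem_coneIntR_of_det2_pos {v w x : ℤ × ℤ} (hvw : det2 v w = 1)
    (hv : 0 < det2 v x) (hw : 0 < det2 x w) : toR2 x ∈ coneIntR v w := by
  refine ⟨det2 x w, det2 v x, by exact_mod_cast hw, by exact_mod_cast hv, ?_⟩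
  have h : (v.1 * w.2 - v.2 * w.1 : ℝ) = 1 := by
    have := congrArg (Int.cast : ℤ → ℝ) hvw
    simpa [det2] using this
  ext
  · simp only [toR2, det2, Prod.fst_add, Prod.smul_fst, smul_eq_mul]
    push_cast
    linear_combination (-(x.1 : ℝ)) * h
  · simp only [toR2, det2, Prod.snd_add, Prod.smul_snd, smul_eq_mul]
    push_cast
    linear_combination (-(x.2 : ℝ)) * h

namespace IsCompleteSmoothFan

variable {n : ℕ} {u : ZMod n → ℤ × ℤ}

theorem eq_of_det2_pos (hu : IsCompleteSmoothFan u) {i j : ZMod n} {x : ℤ × ℤ}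
    (hi : 0 < det2 (u i) x) (hi' : 0 < det2 x (u (i + 1)))
    (hj : 0 < det2 (u j) x) (hj' : 0 < det2 x (u (j + 1))) : i = j := by
  by_contra hij
  have hx : toR2 x ∈ coneIntR (u i) (u (i + 1)) ∩ coneIntR (u j) (u (j + 1)) :=
    ⟨mem_coneIntR_of_det2_pos (hu.det_succ i) hi hi',
      mem_coneIntR_of_det2_pos (hu.det_succ j) hj hj'⟩
  rw [hu.disjoint_interiors i j hij] at hx
  exact hx

/-- If `det(u i, u (i+2)) ≤ 0`, the cones `i` and `i + 1` fill the open half-plane to the left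
of `u i`, except for the ray through `u (i+1)`. A point of the interior of another cone that lies
in this half-plane must therefore lie on that ray. -/
theorem det2_eq_zero_of_det2_pos (hu : IsCompleteSmoothFan u) {i k : ZMod n}
    (hγ : det2 (u i) (u (i + 1 + 1)) ≤ 0) (hki : k ≠ i) (hki' : k ≠ i + 1) {x : ℤ × ℤ}
    (hx : 0 < det2 (u i) x) (hk : 0 < det2 (u k) x) (hk' : 0 < det2 x (u (k + 1))) :
    det2 x (u (i + 1)) = 0 := by
  rcases lt_trichotomy (det2 x (u (i + 1))) 0 with h | h | h
  · refine absurd (hu.eq_of_det2_pos hk hk' (j := i + 1) ?_ ?_) hki'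
    · simp only [det2] at h ⊢
      linarith
    · have h₁ := hu.det_succ i
      have h₂ := hu.det_succ (i + 1)
      have key : det2 x (u (i + 1 + 1)) =
          det2 (u i) (u (i + 1 + 1)) * det2 x (u (i + 1)) + det2 (u i) x := by
        simp only [det2] at h₁ h₂ ⊢
        linear_combination (-((x.1 * (u (i + 1 + 1)).2 - x.2 * (u (i + 1 + 1)).1))) * h₁ +
          ((u i).1 * x.2 - (u i).2 * x.1) * h₂
      nlinarith [mul_nonneg_of_nonpos_of_nonpos hγ h.le]
  · exact h
  · exact absurd (hu.eq_of_det2_pos hk hk' hx h) hki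

theorem det2_nonpos_of_ne (hu : IsCompleteSmoothFan u) {i k : ZMod n}
    (hγ : det2 (u i) (u (i + 1 + 1)) ≤ 0) (hki : k ≠ i) (hki' : k ≠ i + 1) :
    det2 (u i) (u k) ≤ 0 ∧ det2 (u i) (u (k + 1)) ≤ 0 := by
  have hvw := hu.det_succ k
  have hpq := hu.det_succ i
  set p := u i
  set q := u (i + 1)
  set v := u k
  set w := u (k + 1)
  have comb (s t : ℤ) (hs : 0 < s) (ht : 0 < t) (h : 0 < s * det2 p v + t * det2 p w) :
      s * det2 v q + t * det2 w q = 0 := by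
    have := hu.det2_eq_zero_of_det2_pos hγ hki hki' (x := (s * v.1 + t * w.1, s * v.2 + t * w.2))
      (lt_of_lt_of_eq h (by simp only [det2]; ring))
      (by simp only [det2] at hvw ⊢; linear_combination ht - t * hvw)
      (by simp only [det2] at hvw ⊢; linear_combination hs - s * hvw)
    simp only [det2] at this ⊢
    linear_combination this
  have indep (hv : det2 v q = 0) (hw : det2 w q = 0) : False := by
    have : det2 p q = 0 := by
      have : det2 p q * det2 v w = 0 := by
        simp only [det2] at hv hw ⊢
        linear_combination (p.1 * w.2 - p.2 * w.1) * hv - (p.1 * v.2 - p.2 * v.1) * hw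
      simpa [hvw] using this
    omega
  have bound (c d : ℤ) (hc : 0 < c) : 0 < (1 + |d|) * c + d := by
    nlinarith [neg_abs_le d, abs_nonneg d]
  constructor <;> by_contra! h
  · have h₁ := comb (1 + |det2 p w|) 1 (by positivity) one_pos (by linarith [bound _ (det2 p w) h])
    have h₂ := comb (1 + |det2 p w| + 1) 1 (by positivity) one_pos
      (by linarith [bound _ (det2 p w) h])
    have hv : det2 v q = 0 := by linear_combination h₂ - h₁
    exact indep hv (by rw [hv] at h₁; linear_combination h₁)
  · have h₁ := comb 1 (1 + |det2 p v|) one_pos (by positivity) (by linarith [bound _ (det2 p v) h])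
    have h₂ := comb 1 (1 + |det2 p v| + 1) one_pos (by positivity)
      (by linarith [bound _ (det2 p v) h])
    have hw : det2 w q = 0 := by linear_combination h₂ - h₁
    exact indep (by rw [hw] at h₁; linear_combination h₁) hw

theorem det2_eq_zero_of_nonpos (hu : IsCompleteSmoothFan u) {i j : ZMod n}
    (hγi : det2 (u i) (u (i + 1 + 1)) ≤ 0) (hγj : det2 (u j) (u (j + 1 + 1)) ≤ 0)
    (h₁ : j ≠ i) (h₂ : j ≠ i + 1) (h₃ : j + 1 ≠ i) :
    det2 (u i) (u j) = 0 ∧ det2 (u i) (u (j + 1)) ≤ 0 := by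
  obtain ⟨hp, hq⟩ := hu.det2_nonpos_of_ne hγi h₁ h₂
  obtain ⟨-, hr⟩ := hu.det2_nonpos_of_ne hγi (k := j + 1) h₃ (by simpa using h₁)
  have d₁ := hu.det_succ j
  have d₂ := hu.det_succ (j + 1)
  have key : det2 (u i) (u j) + det2 (u i) (u (j + 1 + 1)) =
      det2 (u j) (u (j + 1 + 1)) * det2 (u i) (u (j + 1)) := by
    simp only [det2] at d₁ d₂ ⊢
    linear_combination
      (-((u i).1 * (u (j + 1 + 1)).2 - (u i).2 * (u (j + 1 + 1)).1)) * d₁ -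
        ((u i).1 * (u j).2 - (u i).2 * (u j).1) * d₂
  have := mul_nonneg_of_nonpos_of_nonpos hγj hq
  exact ⟨by linarith, hq⟩

/-- A complete smooth fan cannot contain two non-overlapping pairs of consecutive cones, each
spanning an angle of at least `π`, together with a fifth cone. -/
theorem false_of_two_nonpos (hu : IsCompleteSmoothFan u) {i j k : ZMod n}
    (hγi : det2 (u i) (u (i + 1 + 1)) ≤ 0) (hγj : det2 (u j) (u (j + 1 + 1)) ≤ 0)
    (h₁ : j ≠ i) (h₂ : j ≠ i + 1) (h₃ : j + 1 ≠ i)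
    (hki : k ≠ i) (hki' : k ≠ i + 1) (hkj : k ≠ j) (hkj' : k ≠ j + 1) : False := by
  obtain ⟨hpp, hc⟩ := hu.det2_eq_zero_of_nonpos hγi hγj h₁ h₂ h₃
  obtain ⟨hv, hw⟩ := hu.det2_nonpos_of_ne hγi hki hki'
  obtain ⟨hv', hw'⟩ := hu.det2_nonpos_of_ne hγj hkj hkj'
  have dj := hu.det_succ j
  have di := hu.det_succ i
  have dk := hu.det_succ k
  have key (x : ℤ × ℤ) : det2 (u i) x = det2 (u i) (u (j + 1)) * det2 (u j) x := by
    simp only [det2] at hpp dj ⊢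
    linear_combination (-((u i).1 * x.2 - (u i).2 * x.1)) * dj +
      (x.1 * (u (j + 1)).2 - x.2 * (u (j + 1)).1) * hpp
  have hv₀ : det2 (u i) (u k) = 0 :=
    le_antisymm hv (key (u k) ▸ mul_nonneg_of_nonpos_of_nonpos hc hv')
  have hw₀ : det2 (u i) (u (k + 1)) = 0 :=
    le_antisymm hw (key (u (k + 1)) ▸ mul_nonneg_of_nonpos_of_nonpos hc hw')
  have : det2 (u i) (u (i + 1)) * det2 (u k) (u (k + 1)) = 0 := by
    generalize u (i + 1) = q
    simp only [det2] at hv₀ hw₀ ⊢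
    linear_combination ((u k).1 * q.2 - (u k).2 * q.1) * hw₀ -
      ((u (k + 1)).1 * q.2 - (u (k + 1)).2 * q.1) * hv₀
  rw [di, dk] at this
  omega

end IsCompleteSmoothFan

theorem ZMod.natCast_ne_zero_of_lt {n m : ℕ} (hm : 0 < m) (hmn : m < n) : (m : ZMod n) ≠ 0 := by
  rw [Ne, ZMod.natCast_eq_zero_iff]
  exact Nat.not_dvd_of_pos_of_lt hm hmn

/-- For a complete smooth toric surface `X` with `rk Pic(X) ≥ 3` (i.e. `n ≥ 5` rays)
and any nonzero reduced torus-invariant divisor `D = Σ_{i∈Δ} D_i`, the divisor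
`-(K_X + D)` is not ample: some ampleness inequality
`a_{i-1} + a_{i+1} - γ_i a_i > 0` fails. -/
theorem not_log_del_pezzo_of_picard_rank_ge_three {n : ℕ} (hn : 5 ≤ n)
    (u : ZMod n → ℤ × ℤ) (hu : IsCompleteSmoothFan u)
    (γ : ZMod n → ℤ) (hγ : ∀ i, γ i = det2 (u (i - 1)) (u (i + 1)))
    (Δ : Finset (ZMod n)) (hΔ : Δ.Nonempty)
    (a : ZMod n → ℤ) (ha : ∀ i, a i = if i ∈ Δ then 0 else 1) :
    ∃ i : ZMod n, a (i - 1) + a (i + 1) - γ i * a i ≤ 0 := by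
  by_contra! H
  have z₁ : (1 : ZMod n) ≠ 0 := by
    simpa using ZMod.natCast_ne_zero_of_lt (n := n) (m := 1) (by omega) (by omega)
  have z₂ : (2 : ZMod n) ≠ 0 := by
    simpa using ZMod.natCast_ne_zero_of_lt (n := n) (m := 2) (by omega) (by omega)
  have z₃ : (3 : ZMod n) ≠ 0 := by
    simpa using ZMod.natCast_ne_zero_of_lt (n := n) (m := 3) (by omega) (by omega)
  have z₄ : (4 : ZMod n) ≠ 0 := by
    simpa using ZMod.natCast_ne_zero_of_lt (n := n) (m := 4) (by omega) (by omega)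
  have a_mem {i} (hi : i ∈ Δ) : a i = 0 := by rw [ha, if_pos hi]
  have a_notMem {i} (hi : i ∉ Δ) : a i = 1 := by rw [ha, if_neg hi]
  have a_le (i) : a i ≤ 1 := by rw [ha]; split_ifs <;> simp
  have right {d} (hd : d ∈ Δ) (h : d + 1 ∉ Δ) : det2 (u d) (u (d + 1 + 1)) ≤ 0 := by
    have h₁ := H (d + 1)
    rw [hγ, a_notMem h, add_sub_cancel_right, a_mem hd] at h₁
    linarith [a_le (d + 1 + 1)]
  have left {d} (hd : d ∈ Δ) (h : d - 1 ∉ Δ) : det2 (u (d - 2)) (u (d - 2 + 1 + 1)) ≤ 0 := by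
    have h₁ := H (d - 1)
    rw [hγ, a_notMem h, sub_add_cancel, a_mem hd] at h₁
    rw [show d - 2 + 1 + 1 = d by ring, show d - 2 = d - 1 - 1 by ring]
    linarith [a_le (d - 1 - 1)]
  have no_three {d} (hd : d ∈ Δ) (h : d - 1 ∈ Δ) (h' : d + 1 ∈ Δ) : False := by
    have h₁ := H d
    rw [a_mem hd, a_mem h, a_mem h'] at h₁
    simp at h₁
  have no_two {d} (hd : d ∈ Δ) (h : d + 1 ∈ Δ) : False := by
    have hl : d - 1 ∉ Δ := fun h' ↦ no_three hd h' h
    have hr : d + 1 + 1 ∉ Δ := fun h' ↦ no_three h (by simpa using hd) h'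
    refine hu.false_of_two_nonpos (k := d) (right h hr) (left hd hl) ?_ ?_ ?_ ?_ ?_ ?_ ?_ <;>
      intro e
    · exact z₃ (by linear_combination -e)
    · exact z₄ (by linear_combination -e)
    · exact z₂ (by linear_combination -e)
    · exact z₁ (by linear_combination -e)
    · exact z₂ (by linear_combination -e)
    · exact z₂ (by linear_combination e)
    · exact z₁ (by linear_combination e)
  obtain ⟨d, hd⟩ := hΔ
  have hl : d - 1 ∉ Δ := fun h ↦ no_two h (by simpa using hd)
  have hr : d + 1 ∉ Δ := fun h ↦ no_two hd h
  refine hu.false_of_two_nonpos (k := d + 2) (right hd hr) (left hd hl) ?_ ?_ ?_ ?_ ?_ ?_ ?_ <;>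
    intro e
  · exact z₂ (by linear_combination -e)
  · exact z₃ (by linear_combination -e)
  · exact z₁ (by linear_combination -e)
  · exact z₂ (by linear_combination e)
  · exact z₁ (by linear_combination e)
  · exact z₄ (by linear_combination e)
  · exact z₃ (by linear_combination e)
end

section
/- Let n ≥ 3 and let u : ZMod n → ℤ² be the ray data of a complete smooth fan in ℝ² (each u_i primitive, det(u_i, u_{i+1}) = 1 for all i, the cones Cone(u_i, u_{i+1}) cover ℝ², and distinct such cones have disjoint interiors), and set γ_i = det(u_{i-1}, u_{i+1}). Let Δ ⊆ ZMod n with card(Δ) ≥ 3 and define a_i = 0 if i ∈ Δ and a_i = 1 otherwise. Then there exists i ∈ ZMod n such that a_{i-1} + a_{i+1} - γ_i · a_i ≤ 0. (Equivalently, for a complete smooth toric surface X and a reduced invariant divisor D = Σ_{i∈Δ} D_i with at least three components, -(K_X + D) is not ample.) -/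
/-- A positive combination of the generators, certified by two positive determinants. -/
theorem toR2_mem_coneIntR {p q x : ℤ × ℤ} (hpq : det2 p q = 1)
    (hp : 0 < det2 p x) (hq : 0 < det2 x q) : toR2 x ∈ coneIntR p q := by
  refine ⟨(det2 x q : ℝ), (det2 p x : ℝ), by exact_mod_cast hq, by exact_mod_cast hp, ?_⟩
  have h1 : x.1 = det2 x q * p.1 + det2 p x * q.1 := by
    simp only [det2] at *
    linear_combination (-x.1) * hpq
  have h2 : x.2 = det2 x q * p.2 + det2 p x * q.2 := by
    simp only [det2] at *
    linear_combination (-x.2) * hpq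
  ext
  · simp only [toR2, Prod.smul_mk, Prod.mk_add_mk, smul_eq_mul]
    exact_mod_cast h1
  · simp only [toR2, Prod.smul_mk, Prod.mk_add_mk, smul_eq_mul]
    exact_mod_cast h2

/-- If `v` lies in the half-open cone `[p, q)`, then every smooth cone with first generator `v`
has interior points in common with `Cone(p, q)`. -/
theorem coneIntR_inter_nonempty {p q v w : ℤ × ℤ} (hpq : det2 p q = 1) (hvw : det2 v w = 1)
    (hp : 0 ≤ det2 p v) (hq : 0 < det2 v q) :
    (coneIntR p q ∩ coneIntR v w).Nonempty := by
  obtain ⟨N, hN⟩ : ∃ N : ℤ, N = 1 + |det2 p w| + |det2 w q| := ⟨_, rfl⟩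
  have hpw := neg_abs_le (det2 p w)
  have hwq := neg_abs_le (det2 w q)
  have hpw' := abs_nonneg (det2 p w)
  have hwq' := abs_nonneg (det2 w q)
  have hN0 : 0 < N := by linarith
  have e1 : det2 p (N * v.1 + w.1, N * v.2 + w.2) = N * det2 p v + det2 p w := by
    simp only [det2]; ring
  have e2 : det2 (N * v.1 + w.1, N * v.2 + w.2) q = N * det2 v q + det2 w q := by
    simp only [det2]; ring
  have e3 : det2 v (N * v.1 + w.1, N * v.2 + w.2) = 1 := by
    simp only [det2] at *; linear_combination hvw
  have e4 : det2 (N * v.1 + w.1, N * v.2 + w.2) w = N := by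
    simp only [det2] at *; linear_combination N * hvw
  refine ⟨toR2 (N * v.1 + w.1, N * v.2 + w.2), toR2_mem_coneIntR hpq ?_ ?_,
    toR2_mem_coneIntR hvw (by rw [e3]; exact one_pos) (by rwa [e4])⟩
  · rw [e1]
    rcases hp.eq_or_lt with h | h
    · have plucker : det2 v q * det2 p w = 1 := by
        have : det2 v q * det2 p w = det2 p v * det2 w q + det2 p q * det2 v w := by
          simp only [det2]; ring
        rw [this, ← h, hpq, hvw]; norm_num
      have : 0 < det2 p w := by
        by_contra! hc
        nlinarith
      rw [← h]; simpa using this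
    · nlinarith
  · rw [e2]
    nlinarith

/-- In a chain of smooth cones whose interiors miss the one at `U t`, the rays strictly between
`U 0` and `U t` lie in the open half-plane to the left of `U 0` as soon as `U t` lies in the
closed one. -/
theorem det2_pos_of_disjoint {U : ℕ → ℤ × ℤ} {t : ℕ} (hU : ∀ k, det2 (U k) (U (k + 1)) = 1)
    (hdisj : ∀ k < t, coneIntR (U k) (U (k + 1)) ∩ coneIntR (U t) (U (t + 1)) = ∅)
    (h0 : 0 ≤ det2 (U 0) (U t)) : ∀ k, 0 < k → k < t → 0 < det2 (U 0) (U k) := by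
  have key : ∀ k < t, 0 ≤ det2 (U k) (U t) → 0 ≤ det2 (U (k + 1)) (U t) := by
    intro k hk h
    by_contra! hc
    have hne := coneIntR_inter_nonempty (hU k) (hU t) h
      (by simp only [det2] at *; linarith)
    exact hne.ne_empty (hdisj k hk)
  have hg : ∀ k ≤ t, 0 ≤ det2 (U k) (U t) := by
    intro k
    induction k with
    | zero => exact fun _ => h0
    | succ k ih => exact fun hk => key k hk (ih (by omega))
  intro k hk
  induction k, hk using Nat.le_induction with
  | base => intro _; rw [show det2 (U 0) (U 1) = 1 from hU 0]; exact one_pos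
  | succ k hk ih =>
    intro hkt
    have hd := ih (by omega)
    by_contra! hc
    have plucker : det2 (U 0) (U k) * det2 (U (k + 1)) (U t)
        - det2 (U 0) (U (k + 1)) * det2 (U k) (U t) + det2 (U 0) (U t) = 0 := by
      have := hU k
      simp only [det2] at *
      linear_combination (-((U 0).1 * (U t).2 - (U 0).2 * (U t).1)) * this
    have g1 := hg k (by omega)
    have g2 := hg (k + 1) (by omega)
    have m1 := mul_nonneg hd.le g2
    have m2 := mul_nonneg (neg_nonneg.2 hc) g1
    have z : det2 (U (k + 1)) (U t) = 0 := by
      have : det2 (U 0) (U k) * det2 (U (k + 1)) (U t) = 0 := by linarith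
      exact (mul_eq_zero.1 this).resolve_left hd.ne'
    have unit : ∀ w, det2 (U k) (U t) * det2 (U (k + 1)) w = det2 (U t) w := by
      intro w
      have := hU k
      simp only [det2] at *
      linear_combination ((U t).1 * w.2 - (U t).2 * w.1) * this
        + ((U k).1 * w.2 - (U k).2 * w.1) * z
    have hpos : 0 < det2 (U k) (U t) := by
      refine lt_of_le_of_ne g1 fun h => ?_
      have := unit (U (t + 1))
      rw [← h, hU t] at this
      simp at this
    have hne := coneIntR_inter_nonempty (hU (k + 1)) (hU t) g2
      (by rw [← unit, hU (k + 1), mul_one]; exact hpos)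
    exact hne.ne_empty (hdisj (k + 1) hkt)

/-- A discrete Sturm comparison: a nonnegative strictly convex sequence vanishing at `0` and `t`
forces `t ≤ 1` if the rays `U 1, …, U (t - 1)` lie strictly to the left of `U 0` and `U t` does
not lie to its right. -/
theorem le_one_of_strictly_convex {U : ℕ → ℤ × ℤ} {A : ℕ → ℤ} {t : ℕ}
    (hU : ∀ k, det2 (U k) (U (k + 1)) = 1) (hA : ∀ k, 0 ≤ A k)
    (hconv : ∀ k, 0 < A k + A (k + 2) - det2 (U k) (U (k + 2)) * A (k + 1))
    (hpos : ∀ k, 0 < k → k < t → 0 < det2 (U 0) (U k)) (ht : 0 ≤ det2 (U 0) (U t))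
    (hA0 : A 0 = 0) (hAt : A t = 0) : t ≤ 1 := by
  have step : ∀ k, A (k + 2) * det2 (U 0) (U (k + 1)) - A (k + 1) * det2 (U 0) (U (k + 2))
      = A (k + 1) * det2 (U 0) (U k) - A k * det2 (U 0) (U (k + 1))
        + det2 (U 0) (U (k + 1)) *
          (A k + A (k + 2) - det2 (U k) (U (k + 2)) * A (k + 1)) := by
    intro k
    have h1 := hU k
    have h2 : det2 (U (k + 1)) (U (k + 2)) = 1 := hU (k + 1)
    simp only [det2] at *
    linear_combination
      A (k + 1) * ((U 0).1 * (U (k + 2)).2 - (U 0).2 * (U (k + 2)).1) * h1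
        + A (k + 1) * ((U 0).1 * (U k).2 - (U 0).2 * (U k).1) * h2
  have wronskian : ∀ k, k + 1 < t →
      0 < A (k + 2) * det2 (U 0) (U (k + 1)) - A (k + 1) * det2 (U 0) (U (k + 2)) := by
    intro k
    induction k with
    | zero =>
      intro h
      have h00 : det2 (U 0) (U 0) = 0 := by simp only [det2]; ring
      rw [step, h00, hA0]
      have := mul_pos (hpos 1 one_pos h) (hconv 0)
      simp only [hA0] at this
      simpa using this
    | succ k ih =>
      intro h
      rw [step]
      exact add_pos (ih (by omega)) (mul_pos (hpos _ (by omega) h) (hconv _))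
  by_contra! hlt
  obtain ⟨s, rfl⟩ : ∃ s, t = s + 2 := ⟨t - 2, by omega⟩
  have := wronskian s (by omega)
  rw [hAt] at this
  have := mul_nonneg (hA (s + 1)) ht
  linarith

/-- For a complete smooth toric surface `X` and a reduced invariant divisor
`D = Σ_{i∈Δ} D_i` with at least three components, `-(K_X + D)` is not ample:
some ampleness inequality `a_{i-1} + a_{i+1} - γ_i a_i > 0` fails. -/
theorem not_ample_of_three_le_card {n : ℕ} (hn : 3 ≤ n)
    (u : ZMod n → ℤ × ℤ) (hu : IsCompleteSmoothFan u)
    (γ : ZMod n → ℤ) (hγ : ∀ i, γ i = det2 (u (i - 1)) (u (i + 1)))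
    (Δ : Finset (ZMod n)) (hΔ : 3 ≤ Δ.card)
    (a : ZMod n → ℤ) (ha : ∀ i, a i = if i ∈ Δ then 0 else 1) :
    ∃ i : ZMod n, a (i - 1) + a (i + 1) - γ i * a i ≤ 0 := by
  have : NeZero n := ⟨by omega⟩
  by_contra! hcon
  have hanonneg : ∀ i, 0 ≤ a i := fun i => by rw [ha]; split_ifs <;> norm_num
  have hazero : ∀ i ∈ Δ, a i = 0 := fun i hi => by rw [ha, if_pos hi]
  have hsucc : ∀ i ∈ Δ, ∀ j ∈ Δ, i ≠ j → 0 ≤ det2 (u i) (u j) → j = i + 1 := by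
    intro i hi j hj hij hdet
    obtain ⟨t, htn, rfl⟩ : ∃ t : ℕ, t < n ∧ i + (t : ZMod n) = j :=
      ⟨(j - i).val, ZMod.val_lt _, by rw [ZMod.natCast_zmod_val]; ring⟩
    have hU : ∀ k : ℕ, det2 (u (i + k)) (u (i + (k + 1 : ℕ))) = 1 := fun k => by
      have := hu.det_succ (i + k)
      rwa [add_assoc, ← Nat.cast_succ] at this
    have hdet' : 0 ≤ det2 (u (i + (0 : ℕ))) (u (i + t)) := by simpa using hdet
    have hpos := det2_pos_of_disjoint (U := fun k : ℕ => u (i + k)) (t := t) hU (fun k hk => by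
      have hne : i + (k : ZMod n) ≠ i + t := fun h => by
        have h := congrArg ZMod.val (add_left_cancel h)
        rw [ZMod.val_cast_of_lt (by omega), ZMod.val_cast_of_lt htn] at h
        omega
      have := hu.disjoint_interiors _ _ hne
      rwa [add_assoc, add_assoc, ← Nat.cast_succ, ← Nat.cast_succ] at this) hdet'
    have hle := le_one_of_strictly_convex (U := fun k : ℕ => u (i + k))
      (A := fun k : ℕ => a (i + k)) (t := t) hU (fun k => hanonneg _) (fun k => by
        have := hcon (i + (k + 1 : ℕ))
        rw [hγ] at this
        rwa [show i + ((k + 1 : ℕ) : ZMod n) - 1 = i + k by push_cast; ring,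
          show i + ((k + 1 : ℕ) : ZMod n) + 1 = i + (k + 2 : ℕ) by push_cast; ring] at this)
      hpos hdet' (by simpa using hazero i hi) (hazero _ hj)
    interval_cases t
    · simp at hij
    · simp
  have hadj : ∀ i ∈ Δ, ∀ j ∈ Δ, i ≠ j → j = i + 1 ∨ i = j + 1 := by
    intro i hi j hj hij
    rcases le_total 0 (det2 (u i) (u j)) with h | h
    · exact Or.inl (hsucc i hi j hj hij h)
    · exact Or.inr (hsucc j hj i hi hij.symm (by simp only [det2] at *; linarith))
  have hmid : ∀ i ∈ Δ, i + 1 ∈ Δ → i + 1 + 1 ∉ Δ := by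
    intro i h0 h1 h2
    have := hcon (i + 1)
    rw [add_sub_cancel_right, hazero _ h0, hazero _ h1, hazero _ h2] at this
    simp at this
  obtain ⟨x, y, z, hx, hy, hz, hxy, hxz, hyz⟩ := Finset.two_lt_card_iff.1 hΔ
  rcases hadj x hx y hy hxy with rfl | rfl
  · rcases hadj _ hy z hz hyz with rfl | h
    · exact hmid _ hx hy hz
    · exact hxz (add_right_cancel h)
  · rcases hadj _ hx z hz hxz with rfl | h
    · exact hmid _ hy hx hz
    · exact hyz (add_right_cancel h)
end

section
/- Let n ≥ 5 and let u : ZMod n → ℤ² be the ray data of a complete smooth fan in ℝ² (each u_i primitive, det(u_i, u_{i+1}) = 1 for all i, the cones Cone(u_i, u_{i+1}) cover ℝ², and distinct such cones have disjoint interiors). Then it is not the case that both det(u_0, u_2) ≤ 0 and det(u_{n-2}, u_0) ≤ 0; that is, γ_1 > 0 or γ_{n-1} > 0, where γ_i = det(u_{i-1}, u_{i+1}). (This is the key step showing that -(K_X + D_0) is not ample when the Picard rank of X is at least 3.) -/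
/-- An integral vector with positive coordinates in the unimodular basis `v, w` lies in the
interior of `Cone(v, w)`. -/
lemma toR2_mem_coneIntR_s8 {v w p : ℤ × ℤ} (h : det2 v w = 1) (hs : 0 < det2 p w)
    (ht : 0 < det2 v p) : toR2 p ∈ coneIntR v w := by
  refine ⟨det2 p w, det2 v p, mod_cast hs, mod_cast ht, ?_⟩
  have h1 : p.1 = det2 p w * v.1 + det2 v p * w.1 := by
    unfold det2 at *; linear_combination (-p.1) * h
  have h2 : p.2 = det2 p w * v.2 + det2 v p * w.2 := by
    unfold det2 at *; linear_combination (-p.2) * h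
  ext
  · simpa [toR2] using congrArg (Int.cast : ℤ → ℝ) h1
  · simpa [toR2] using congrArg (Int.cast : ℤ → ℝ) h2

/-- If `v, w` is a unimodular basis and `x` is nonzero, then `k v + w` is not parallel to `x` for
`k` large. -/
lemma det2_smul_add_ne_zero {v w x : ℤ × ℤ} (h : det2 v w = 1) (hx : x ≠ 0) {k : ℤ}
    (hk : |det2 w x| < k) : det2 (k • v + w) x ≠ 0 := by
  have e : det2 (k • v + w) x = k * det2 v x + det2 w x := by
    simp only [det2, Prod.fst_add, Prod.snd_add, Prod.smul_fst, Prod.smul_snd, smul_eq_mul]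
    ring
  intro h0
  rw [e] at h0
  have hw : det2 w x = 0 := Int.eq_zero_of_abs_lt_dvd ⟨-det2 v x, by linarith⟩ hk
  have hk0 : k ≠ 0 := by have := abs_nonneg (det2 w x); omega
  have hv : det2 v x = 0 := by simpa [hw, hk0] using h0
  apply hx
  unfold det2 at *
  ext
  · rw [Prod.fst_zero]
    linear_combination (-x.1) * h + w.1 * hv - v.1 * hw
  · rw [Prod.snd_zero]
    linear_combination (-x.2) * h + w.2 * hv - v.2 * hw

/-- If `det(v, w) = det(w, x) = 1` and `det(v, x) ≤ 0`, then `Cone(v, w)` and `Cone(w, x)`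
together contain every vector strictly to the left of `v` that is not parallel to `w`. -/
lemma toR2_mem_coneIntR_or_of_det2_pos {v w x p : ℤ × ℤ} (hvw : det2 v w = 1)
    (hwx : det2 w x = 1) (hvx : det2 v x ≤ 0) (hp : 0 < det2 v p) (hpw : det2 p w ≠ 0) :
    toR2 p ∈ coneIntR v w ∨ toR2 p ∈ coneIntR w x := by
  rcases hpw.lt_or_gt with h | h
  · refine .inr (toR2_mem_coneIntR_s8 hwx ?_ ?_)
    · have e : det2 p x = det2 v x * det2 p w + det2 v p := by
        unfold det2 at *
        linear_combination (p.2 * x.1 - p.1 * x.2) * hvw + (v.1 * p.2 - v.2 * p.1) * hwx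
      nlinarith
    · unfold det2 at *; linarith
  · exact .inl (toR2_mem_coneIntR_s8 hvw h hp)

/-- If `det(x, w) = det(w, v) = 1` and `det(x, v) ≤ 0`, then `Cone(x, w)` and `Cone(w, v)`
together contain every vector strictly to the right of `v` that is not parallel to `w`. -/
lemma toR2_mem_coneIntR_or_of_det2_neg {v w x p : ℤ × ℤ} (hxw : det2 x w = 1)
    (hwv : det2 w v = 1) (hxv : det2 x v ≤ 0) (hp : det2 v p < 0) (hpw : det2 p w ≠ 0) :
    toR2 p ∈ coneIntR x w ∨ toR2 p ∈ coneIntR w v := by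
  rcases hpw.lt_or_gt with h | h
  · refine .inr (toR2_mem_coneIntR_s8 hwv ?_ ?_) <;> unfold det2 at * <;> linarith
  · refine .inl (toR2_mem_coneIntR_s8 hxw h ?_)
    have e : det2 x p = -(det2 x v * det2 p w) - det2 v p := by
      unfold det2 at *
      linear_combination (p.1 * x.2 - p.2 * x.1) * hwv - (v.1 * p.2 - v.2 * p.1) * hxw
    nlinarith

/-- For a complete smooth fan in `ℝ²` with `n ≥ 5` rays, it is not the case that
both `det(u_0, u_2) ≤ 0` and `det(u_{n-2}, u_0) ≤ 0` (where `n - 2 = -2` in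
`ZMod n`); that is, `γ_1 > 0` or `γ_{n-1} > 0`. This is the key step showing that
`-(K_X + D_0)` is not ample when the Picard rank of `X` is at least `3`. -/
theorem gamma_one_pos_or_gamma_pred_pos {n : ℕ} (hn : 5 ≤ n)
    (u : ZMod n → ℤ × ℤ) (hu : IsCompleteSmoothFan u) :
    ¬ (det2 (u 0) (u 2) ≤ 0 ∧ det2 (u (-2)) (u 0) ≤ 0) := by
  rintro ⟨h₁, h₂⟩
  have cast_ne (m : ℕ) (h0 : 0 < m) (hm : m < 5) : (m : ZMod n) ≠ 0 := fun h ↦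
    absurd (Nat.le_of_dvd h0 ((ZMod.natCast_eq_zero_iff m n).1 h)) (by omega)
  have n1 : (1 : ZMod n) ≠ 0 := mod_cast cast_ne 1 (by norm_num) (by norm_num)
  have n2 : (2 : ZMod n) ≠ 0 := mod_cast cast_ne 2 (by norm_num) (by norm_num)
  have n3 : (3 : ZMod n) ≠ 0 := mod_cast cast_ne 3 (by norm_num) (by norm_num)
  have n4 : (4 : ZMod n) ≠ 0 := mod_cast cast_ne 4 (by norm_num) (by norm_num)
  have e0 : (0 : ZMod n) + 1 = 1 := by ring
  have e1 : (1 : ZMod n) + 1 = 2 := by ring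
  have em1 : (-1 : ZMod n) + 1 = 0 := by ring
  have em2 : (-2 : ZMod n) + 1 = -1 := by ring
  have d0 := hu.det_succ 0
  have d1 := hu.det_succ 1
  have d2 := hu.det_succ 2
  have dm1 := hu.det_succ (-1)
  have dm2 := hu.det_succ (-2)
  rw [e0] at d0
  rw [e1] at d1
  rw [em1] at dm1
  rw [em2] at dm2
  have ne_zero (i : ZMod n) : u i ≠ 0 := fun h ↦ by simpa [h] using hu.primitive i
  -- A vector in the interior of the cone at `u 2` that is parallel to none of the other rays used.
  obtain ⟨k, hk, hk0, hk1, hkm1⟩ : ∃ k : ℤ, 0 < k ∧ |det2 (u (2 + 1)) (u 0)| < k ∧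
      |det2 (u (2 + 1)) (u 1)| < k ∧ |det2 (u (2 + 1)) (u (-1))| < k := by
    have a := abs_nonneg (det2 (u (2 + 1)) (u 0))
    have b := abs_nonneg (det2 (u (2 + 1)) (u 1))
    have c := abs_nonneg (det2 (u (2 + 1)) (u (-1)))
    exact ⟨|det2 (u (2 + 1)) (u 0)| + |det2 (u (2 + 1)) (u 1)| + |det2 (u (2 + 1)) (u (-1))| + 1,
      by omega, by omega, by omega, by omega⟩
  have p0 := det2_smul_add_ne_zero d2 (ne_zero 0) hk0
  have p1 := det2_smul_add_ne_zero d2 (ne_zero 1) hk1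
  have pm1 := det2_smul_add_ne_zero d2 (ne_zero (-1)) hkm1
  have hp : toR2 (k • u 2 + u (2 + 1)) ∈ coneIntR (u 2) (u (2 + 1)) :=
    ⟨k, 1, mod_cast hk, one_pos, by ext <;> simp [toR2]⟩
  generalize k • u 2 + u (2 + 1) = p at *
  have notMem (j : ZMod n) (hj : 2 - j ≠ 0) : toR2 p ∉ coneIntR (u j) (u (j + 1)) := fun h ↦
    (hu.disjoint_interiors 2 j (sub_ne_zero.1 hj)).subset ⟨hp, h⟩
  have q0 := notMem 0 (by convert n2 using 1; ring)
  have q1 := notMem 1 (by convert n1 using 1; ring)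
  have qm1 := notMem (-1) (by convert n3 using 1; ring)
  have qm2 := notMem (-2) (by convert n4 using 1; ring)
  rw [e0] at q0
  rw [e1] at q1
  rw [em1] at qm1
  rw [em2] at qm2
  have p0' : det2 (u 0) p ≠ 0 := fun h ↦ p0 (by unfold det2 at *; linarith)
  rcases p0'.lt_or_gt with h | h
  · exact (toR2_mem_coneIntR_or_of_det2_neg dm2 dm1 h₂ h pm1).elim qm2 qm1
  · exact (toR2_mem_coneIntR_or_of_det2_pos d0 d1 h₁ h p1).elim q0 q1
end

section
/- Let n ≥ 5 and let u : ZMod n → ℤ² be the ray data of a complete smooth fan in ℝ² (each u_i primitive, det(u_i, u_{i+1}) = 1 for all i, the cones Cone(u_i, u_{i+1}) cover ℝ², and distinct such cones have disjoint interiors). Then it is not the case that both det(u_2, u_4) ≤ 0 and det(u_{n-1}, u_1) ≤ 0; that is, γ_3 > 0 or γ_0 > 0, where γ_i = det(u_{i-1}, u_{i+1}). (This is the key step showing that -(K_X + D_1 + D_2) is not ample when the Picard rank of X is at least 3.) -/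
theorem det2_swap (u v : ℤ × ℤ) : det2 u v = -det2 v u := by
  unfold det2; ring

/-- The Plücker relation for four vectors in `ℤ²`. -/
theorem det2_plucker (a b c d : ℤ × ℤ) :
    det2 a b * det2 c d - det2 a c * det2 b d + det2 a d * det2 b c = 0 := by
  unfold det2; ring

/-- A lattice vector strictly between the generators of a unimodular cone lies in its interior. -/
theorem toR2_mem_coneIntR_s9 {u v x : ℤ × ℤ} (huv : det2 u v = 1)
    (hux : 0 < det2 u x) (hxv : 0 < det2 x v) : toR2 x ∈ coneIntR u v := by
  refine ⟨det2 x v, det2 u x, by exact_mod_cast hxv, by exact_mod_cast hux, ?_⟩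
  have h₁ : x.1 = det2 x v * u.1 + det2 u x * v.1 := by
    unfold det2 at *; linear_combination (-x.1) * huv
  have h₂ : x.2 = det2 x v * u.2 + det2 u x * v.2 := by
    unfold det2 at *; linear_combination (-x.2) * huv
  ext
  · simpa [toR2] using congrArg (Int.cast : ℤ → ℝ) h₁
  · simpa [toR2] using congrArg (Int.cast : ℤ → ℝ) h₂

/-- Two consecutive unimodular cones spanning an angle of at least `π` contain, off the middle
ray, the open half-plane to the left of their first ray. -/
theorem mem_coneIntR_of_det2_left_pos {a b c x : ℤ × ℤ} (hab : det2 a b = 1)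
    (hbc : det2 b c = 1) (hac : det2 a c ≤ 0) (hax : 0 < det2 a x) (hbx : det2 b x ≠ 0) :
    toR2 x ∈ coneIntR a b ∨ toR2 x ∈ coneIntR b c := by
  have hp := det2_plucker a b c x
  rw [hab, hbc, det2_swap c x] at hp
  rcases lt_or_gt_of_ne hbx with h | h
  · exact .inl (toR2_mem_coneIntR_s9 hab hax (by rw [det2_swap]; omega))
  · exact .inr (toR2_mem_coneIntR_s9 hbc h (by nlinarith))

/-- Two consecutive unimodular cones spanning an angle of at least `π` contain, off the middle
ray, the open half-plane to the right of their last ray. -/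
theorem mem_coneIntR_of_det2_right_pos {a b c x : ℤ × ℤ} (hab : det2 a b = 1)
    (hbc : det2 b c = 1) (hac : det2 a c ≤ 0) (hxc : 0 < det2 x c) (hbx : det2 b x ≠ 0) :
    toR2 x ∈ coneIntR a b ∨ toR2 x ∈ coneIntR b c := by
  have hp := det2_plucker a b c x
  rw [hab, hbc, det2_swap c x] at hp
  rcases lt_or_gt_of_ne hbx with h | h
  · exact .inl (toR2_mem_coneIntR_s9 hab (by nlinarith) (by rw [det2_swap]; omega))
  · exact .inr (toR2_mem_coneIntR_s9 hbc h hxc)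

theorem exists_det2_ne_zero {a b c d : ℤ × ℤ} (hab : det2 a b = 1) (hbc : det2 b c = 1)
    (hcd : det2 c d = 1) :
    ∃ x, 0 < det2 c x ∧ 0 < det2 x b ∧ det2 d x ≠ 0 ∧ det2 a x ≠ 0 := by
  set q : ℤ := |det2 b d| + 2 with hq
  have hq2 : 2 ≤ q := by have := abs_nonneg (det2 b d); omega
  refine ⟨(-b.1 - q * c.1, -b.2 - q * c.2), ?_, ?_, ?_, ?_⟩
  · have : det2 c (-b.1 - q * c.1, -b.2 - q * c.2) = det2 b c := by simp only [det2]; ring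
    omega
  · have : det2 (-b.1 - q * c.1, -b.2 - q * c.2) b = q * det2 b c := by simp only [det2]; ring
    rw [this, hbc]; omega
  · have : det2 d (-b.1 - q * c.1, -b.2 - q * c.2) = det2 b d + q * det2 c d := by
      simp only [det2]; ring
    rw [this, hcd]
    have := neg_abs_le (det2 b d)
    omega
  · have : det2 a (-b.1 - q * c.1, -b.2 - q * c.2) = -det2 a b - q * det2 a c := by
      simp only [det2]; ring
    rw [this, hab]
    intro h
    have hdvd : q ∣ 1 := ⟨-det2 a c, by linarith⟩
    have := Int.le_of_dvd one_pos hdvd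
    omega

theorem ZMod.natCast_ne_zero_of_lt_s9 {n k : ℕ} (hk : 0 < k) (hkn : k < n) : (k : ZMod n) ≠ 0 := by
  rw [Ne, ZMod.natCast_eq_zero_iff]
  exact Nat.not_dvd_of_pos_of_lt hk hkn

/-- For a complete smooth fan in `ℝ²` with `n ≥ 5` rays, it is not the case that
both `det(u_2, u_4) ≤ 0` and `det(u_{n-1}, u_1) ≤ 0` (where `n - 1 = -1` in
`ZMod n`); that is, `γ_3 > 0` or `γ_0 > 0`. This is the key step showing that
`-(K_X + D_1 + D_2)` is not ample when the Picard rank of `X` is at least `3`. -/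
theorem gamma_three_pos_or_gamma_zero_pos {n : ℕ} (hn : 5 ≤ n)
    (u : ZMod n → ℤ × ℤ) (hu : IsCompleteSmoothFan u) :
    ¬ (det2 (u 2) (u 4) ≤ 0 ∧ det2 (u (-1)) (u 1) ≤ 0) := by
  rintro ⟨h3, h0⟩
  have e2 : (2 : ZMod n) + 1 = 3 := by norm_num
  have e3 : (3 : ZMod n) + 1 = 4 := by norm_num
  have em : (-1 : ZMod n) + 1 = 0 := by norm_num
  have e0 : (0 : ZMod n) + 1 = 1 := by norm_num
  have e1 : (1 : ZMod n) + 1 = 2 := by norm_num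
  have d0 : det2 (u (-1)) (u 0) = 1 := by simpa using hu.det_succ (-1)
  have d1 : det2 (u 0) (u 1) = 1 := by simpa using hu.det_succ 0
  have d2 : det2 (u 1) (u 2) = 1 := e1 ▸ hu.det_succ 1
  have d3 : det2 (u 2) (u 3) = 1 := e2 ▸ hu.det_succ 2
  have d4 : det2 (u 3) (u 4) = 1 := e3 ▸ hu.det_succ 3
  have n2 : (2 : ZMod n) ≠ 0 := by
    exact_mod_cast ZMod.natCast_ne_zero_of_lt_s9 (n := n) (k := 2) (by omega) (by omega)
  have n3 : (3 : ZMod n) ≠ 0 := by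
    exact_mod_cast ZMod.natCast_ne_zero_of_lt_s9 (n := n) (k := 3) (by omega) (by omega)
  have n4 : (4 : ZMod n) ≠ 0 := by
    exact_mod_cast ZMod.natCast_ne_zero_of_lt_s9 (n := n) (k := 4) (by omega) (by omega)
  have n2' : (2 : ZMod n) ≠ -1 := fun h => n3 (by linear_combination h)
  have n3' : (3 : ZMod n) ≠ -1 := fun h => n4 (by linear_combination h)
  obtain ⟨x, hx2, hx1, hx3, hx0⟩ := exists_det2_ne_zero d1 d2 d3
  have absurd_of_mem : ∀ i j : ZMod n, i ≠ j → toR2 x ∈ coneIntR (u i) (u (i + 1)) →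
      toR2 x ∈ coneIntR (u j) (u (j + 1)) → False := fun i j hij hi hj =>
    (hu.disjoint_interiors i j hij).subset ⟨hi, hj⟩
  rcases mem_coneIntR_of_det2_left_pos d3 d4 h3 hx2 hx3 with h | h <;>
    rcases mem_coneIntR_of_det2_right_pos d0 d1 h0 hx1 hx0 with h' | h'
  · exact absurd_of_mem 2 (-1) n2' (by rwa [e2]) (by rwa [em])
  · exact absurd_of_mem 2 0 n2 (by rwa [e2]) (by rwa [e0])
  · exact absurd_of_mem 3 (-1) n3' (by rwa [e3]) (by rwa [em])
  · exact absurd_of_mem 3 0 n3 (by rwa [e3]) (by rwa [e0])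
end

section
/- Let n ≥ 3 and let u : ZMod n → ℤ² be the ray data of a complete smooth fan in ℝ² (each u_i primitive, det(u_i, u_{i+1}) = 1 for all i, the cones Cone(u_i, u_{i+1}) cover ℝ², and distinct such cones have disjoint interiors), and set γ_i = det(u_{i-1}, u_{i+1}). Let p, q ∈ ZMod n with q ∉ {p - 1, p, p + 1} (two non-adjacent indices), let Δ = {p, q}, and define a_i = 0 if i ∈ Δ and a_i = 1 otherwise. Then there exists i ∈ ZMod n such that a_{i-1} + a_{i+1} - γ_i · a_i ≤ 0. (Equivalently, -(K_X + D_p + D_q) is not ample when the components D_p and D_q are non-adjacent in the fan.) -/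
namespace IsCompleteSmoothFan

variable {n : ℕ} {u : ZMod n → ℤ × ℤ}

/-- A lattice point with positive coordinates in the basis `v, w` lies in the open cone. -/
lemma toR2_mem_coneIntR {v w x : ℤ × ℤ} (h : det2 v w = 1) (hv : 0 < det2 v x)
    (hw : 0 < det2 x w) : toR2 x ∈ coneIntR v w := by
  refine ⟨det2 x w, det2 v x, by exact_mod_cast hw, by exact_mod_cast hv, ?_⟩
  have h₁ : x.1 = det2 x w * v.1 + det2 v x * w.1 := by
    simp only [det2] at *; linear_combination -x.1 * h
  have h₂ : x.2 = det2 x w * v.2 + det2 v x * w.2 := by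
    simp only [det2] at *; linear_combination -x.2 * h
  ext
  · simpa [toR2] using congrArg (Int.cast : ℤ → ℝ) h₁
  · simpa [toR2] using congrArg (Int.cast : ℤ → ℝ) h₂

lemma not_mem_two_cones (hu : IsCompleteSmoothFan u) {i j : ZMod n} (hij : i ≠ j) {x : ℤ × ℤ}
    (hi : 0 < det2 (u i) x) (hi' : 0 < det2 x (u (i + 1)))
    (hj : 0 < det2 (u j) x) (hj' : 0 < det2 x (u (j + 1))) : False := by
  have h : toR2 x ∈ coneIntR (u i) (u (i + 1)) ∩ coneIntR (u j) (u (j + 1)) :=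
    ⟨toR2_mem_coneIntR (hu.det_succ i) hi hi', toR2_mem_coneIntR (hu.det_succ j) hj hj'⟩
  rwa [hu.disjoint_interiors i j hij] at h

/-- If `det (u i) (u (i + 2)) ≤ 0`, the open cones at `i` and `i + 1` contain all lattice points
of the half-plane to the left of `u i` that are off the line through `u (i + 1)`. -/
lemma mem_cone_of_halfPlane (hu : IsCompleteSmoothFan u) {i : ZMod n}
    (hi : det2 (u i) (u (i + 1 + 1)) ≤ 0) {x : ℤ × ℤ} (hx : 0 < det2 (u i) x)
    (hx' : det2 x (u (i + 1)) ≠ 0) :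
    ∃ j, (j = i ∨ j = i + 1) ∧ 0 < det2 (u j) x ∧ 0 < det2 x (u (j + 1)) := by
  rcases hx'.lt_or_gt with h | h
  · refine ⟨i + 1, Or.inr rfl, by simp only [det2] at *; linarith, ?_⟩
    have key : det2 x (u (i + 1 + 1)) =
        det2 (u i) x + det2 (u i) (u (i + 1 + 1)) * det2 x (u (i + 1)) := by
      have h₁ := hu.det_succ i
      have h₂ := hu.det_succ (i + 1)
      simp only [det2] at *
      linear_combination (-(x.1 * (u (i + 1 + 1)).2 - x.2 * (u (i + 1 + 1)).1)) * h₁ +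
        ((u i).1 * x.2 - (u i).2 * x.1) * h₂
    nlinarith [mul_nonneg_of_nonpos_of_nonpos hi h.le]
  · exact ⟨i, Or.inl rfl, hx, h⟩

/-- Finitely many lines do not cover the lattice points of an open smooth cone. -/
lemma exists_mem_cone_off_lines {v w : ℤ × ℤ} (h : det2 v w = 1) {l₁ l₂ l₃ : ℤ × ℤ}
    (h₁ : l₁ ≠ 0) (h₂ : l₂ ≠ 0) (h₃ : l₃ ≠ 0) :
    ∃ x : ℤ × ℤ, 0 < det2 v x ∧ 0 < det2 x w ∧
      det2 l₁ x ≠ 0 ∧ det2 l₂ x ≠ 0 ∧ det2 l₃ x ≠ 0 := by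
  have aux : ∀ (l : ℤ × ℤ) (m : ℤ), l ≠ 0 → |det2 l w| < m → det2 l (m • v + w) ≠ 0 := by
    intro l m hl hm h0
    have e : m * det2 l v + det2 l w = 0 := by
      rw [← h0]; simp only [det2, Prod.fst_add, Prod.snd_add, Prod.smul_fst, Prod.smul_snd,
        smul_eq_mul]; ring
    have hlw : det2 l w = 0 := Int.eq_zero_of_abs_lt_dvd (m := m)
      ⟨-det2 l v, by linarith⟩ hm
    have hlv : det2 l v = 0 := by
      have : m ≠ 0 := by have := abs_nonneg (det2 l w); omega
      simpa [hlw, this] using e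
    apply hl
    simp only [det2] at *
    ext
    · simp only [Prod.fst_zero]; linear_combination -l.1 * h + v.1 * hlw - w.1 * hlv
    · simp only [Prod.snd_zero]; linear_combination -l.2 * h + v.2 * hlw - w.2 * hlv
  have n₁ := abs_nonneg (det2 l₁ w)
  have n₂ := abs_nonneg (det2 l₂ w)
  have n₃ := abs_nonneg (det2 l₃ w)
  refine ⟨(|det2 l₁ w| + |det2 l₂ w| + |det2 l₃ w| + 1) • v + w, ?_, ?_,
    aux _ _ h₁ (by linarith), aux _ _ h₂ (by linarith), aux _ _ h₃ (by linarith)⟩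
  · have e : ∀ m : ℤ, det2 v (m • v + w) = 1 := fun m => by
      simp only [det2, Prod.fst_add, Prod.snd_add, Prod.smul_fst, Prod.smul_snd,
        smul_eq_mul] at *
      linear_combination h
    rw [e]
    exact one_pos
  · have e : ∀ m : ℤ, det2 (m • v + w) w = m := fun m => by
      simp only [det2, Prod.fst_add, Prod.snd_add, Prod.smul_fst, Prod.smul_snd,
        smul_eq_mul] at *
      linear_combination m * h
    rw [e]
    linarith

lemma ne_zero (hu : IsCompleteSmoothFan u) (i : ZMod n) : u i ≠ 0 := by
  intro h
  simpa [h, det2] using hu.det_succ i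

/-- Two half-planes that are each filled by two consecutive cones, all four cones being distinct,
are opposite to each other. -/
lemma eq_neg_of_halfPlanes (hu : IsCompleteSmoothFan u) {p q : ZMod n}
    (hpq : p ≠ q) (hpq' : p + 1 ≠ q) (hqp' : q + 1 ≠ p)
    (hp : det2 (u p) (u (p + 1 + 1)) ≤ 0) (hq : det2 (u q) (u (q + 1 + 1)) ≤ 0) :
    u q = -u p := by
  have clash : ∀ x, 0 < det2 (u p) x → det2 x (u (p + 1)) ≠ 0 → 0 < det2 (u q) x →
      det2 x (u (q + 1)) ≠ 0 → False := by
    intro x h₁ h₂ h₃ h₄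
    obtain ⟨i, hi, hi₁, hi₂⟩ := hu.mem_cone_of_halfPlane hp h₁ h₂
    obtain ⟨j, hj, hj₁, hj₂⟩ := hu.mem_cone_of_halfPlane hq h₃ h₄
    refine hu.not_mem_two_cones (i := i) (j := j) ?_ hi₁ hi₂ hj₁ hj₂
    rcases hi with rfl | rfl <;> rcases hj with rfl | rfl
    · exact hpq
    · exact hqp'.symm
    · exact hpq'
    · exact fun h => hpq (add_right_cancel h)
  have dp := hu.det_succ p
  have dq := hu.det_succ q
  by_cases hd : det2 (u p) (u q) = 0
  · have e : u q = det2 (u q) (u (p + 1)) • u p := by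
      simp only [det2] at *
      ext <;> simp only [Prod.smul_fst, Prod.smul_snd, smul_eq_mul]
      · linear_combination -(u q).1 * dp + (u (p + 1)).1 * hd
      · linear_combination -(u q).2 * dp + (u (p + 1)).2 * hd
    have hb : det2 (u q) (u (p + 1)) * det2 (u p) (u (q + 1)) = 1 := by
      rw [← dq]
      conv_rhs => rw [e]
      simp only [det2, Prod.smul_fst, Prod.smul_snd, smul_eq_mul]
      ring
    rcases Int.eq_one_or_neg_one_of_mul_eq_one hb with h | h
    · rw [h, one_smul] at e
      obtain ⟨x, h₁, h₂, h₃, -, -⟩ := exists_mem_cone_off_lines dp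
        (hu.ne_zero (q + 1)) (hu.ne_zero p) (hu.ne_zero p)
      refine (clash x h₁ h₂.ne' (e ▸ h₁) fun h => h₃ ?_).elim
      simp only [det2] at *
      linarith
    · rw [h, neg_one_smul] at e
      exact e
  · set d := det2 (u p) (u q) with hd'
    set b := det2 (u q) (u (p + 1)) with hb
    set c := det2 (u p) (u (q + 1)) with hc
    have hdd : 0 < d * d := mul_self_pos.2 hd
    have hb0 := abs_nonneg b
    have e₁ : det2 (u p) (d • (u q - (|b| + 2) • u p)) = d * d := by
      simp only [hd', det2, Prod.fst_sub, Prod.snd_sub, Prod.smul_fst, Prod.smul_snd, smul_eq_mul]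
      ring
    have e₂ : det2 (d • (u q - (|b| + 2) • u p)) (u (p + 1)) = d * (b - (|b| + 2)) := by
      generalize |b| + 2 = m
      simp only [hb, det2, Prod.fst_sub, Prod.snd_sub, Prod.smul_fst, Prod.smul_snd,
        smul_eq_mul] at dp ⊢
      linear_combination -d * m * dp
    have e₃ : det2 (u q) (d • (u q - (|b| + 2) • u p)) = (|b| + 2) * (d * d) := by
      simp only [hd', det2, Prod.fst_sub, Prod.snd_sub, Prod.smul_fst, Prod.smul_snd, smul_eq_mul]
      ring
    have e₄ : det2 (d • (u q - (|b| + 2) • u p)) (u (q + 1)) = d * (1 - (|b| + 2) * c) := by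
      rw [← dq, hc]
      simp only [det2, Prod.fst_sub, Prod.snd_sub, Prod.smul_fst, Prod.smul_snd, smul_eq_mul]
      ring
    refine (clash (d • (u q - (|b| + 2) • u p)) ?_ ?_ ?_ ?_).elim
    · rwa [e₁]
    · rw [e₂]
      have := le_abs_self b
      exact mul_ne_zero hd (by linarith)
    · rw [e₃]; positivity
    · rw [e₄]
      refine mul_ne_zero hd fun h => ?_
      rcases Int.eq_one_or_neg_one_of_mul_eq_one (show (|b| + 2) * c = 1 by linarith) with h | h <;>
        linarith

/-- A half-plane filled by the cones at `p, p + 1` and one filled by the cones at `q, q + 1` leave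
no room for a further cone. -/
lemma not_halfPlanes_of_fifth_cone (hu : IsCompleteSmoothFan u) {p q r : ZMod n}
    (hpq : p ≠ q) (hpq' : p + 1 ≠ q) (hqp' : q + 1 ≠ p)
    (hrp : r ≠ p) (hrp' : r ≠ p + 1) (hrq : r ≠ q) (hrq' : r ≠ q + 1)
    (hp : det2 (u p) (u (p + 1 + 1)) ≤ 0) (hq : det2 (u q) (u (q + 1 + 1)) ≤ 0) : False := by
  have e := hu.eq_neg_of_halfPlanes hpq hpq' hqp' hp hq
  obtain ⟨x, h₁, h₂, h₃, h₄, h₅⟩ := exists_mem_cone_off_lines (hu.det_succ r)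
    (hu.ne_zero p) (hu.ne_zero (p + 1)) (hu.ne_zero (q + 1))
  have swap : ∀ v : ℤ × ℤ, det2 v x ≠ 0 → det2 x v ≠ 0 := by
    intro v hv h
    apply hv
    simp only [det2] at *
    linarith
  have key : ∀ i, r ≠ i → r ≠ i + 1 → det2 (u i) (u (i + 1 + 1)) ≤ 0 →
      det2 (u (i + 1)) x ≠ 0 → ¬ 0 < det2 (u i) x := by
    intro i hi hi' h h' hx
    obtain ⟨j, hj, hj₁, hj₂⟩ := hu.mem_cone_of_halfPlane h hx (swap _ h')
    refine hu.not_mem_two_cones ?_ h₁ h₂ hj₁ hj₂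
    rcases hj with rfl | rfl <;> assumption
  rcases h₃.lt_or_gt with h | h
  · refine key q hrq hrq' hq h₅ ?_
    rw [e]
    simp only [det2, Prod.fst_neg, Prod.snd_neg] at *
    linarith
  · exact key p hrp hrp' hp h₄ h

end IsCompleteSmoothFan

/-- For a complete smooth toric surface `X` and two non-adjacent indices `p, q`
(`q ∉ {p-1, p, p+1}`), the divisor `-(K_X + D_p + D_q)` is not ample: some
ampleness inequality `a_{i-1} + a_{i+1} - γ_i a_i > 0` fails, where `a_i = 0`
for `i ∈ Δ = {p, q}` and `a_i = 1` otherwise. -/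
theorem not_ample_of_nonadjacent_pair {n : ℕ} (hn : 3 ≤ n)
    (u : ZMod n → ℤ × ℤ) (hu : IsCompleteSmoothFan u)
    (γ : ZMod n → ℤ) (hγ : ∀ i, γ i = det2 (u (i - 1)) (u (i + 1)))
    (p q : ZMod n) (hq : q ∉ ({p - 1, p, p + 1} : Set (ZMod n)))
    (Δ : Finset (ZMod n)) (hΔ : Δ = {p, q})
    (a : ZMod n → ℤ) (ha : ∀ i, a i = if i ∈ Δ then 0 else 1) :
    ∃ i : ZMod n, a (i - 1) + a (i + 1) - γ i * a i ≤ 0 := by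
  by_contra! hpos
  simp only [Set.mem_insert_iff, Set.mem_singleton_iff, not_or] at hq
  obtain ⟨hq₁, hq₂, hq₃⟩ := hq
  have hqp' : q + 1 ≠ p := fun h => hq₁ (eq_sub_of_add_eq h)
  have : Fact (1 < n) := ⟨by omega⟩
  have hp1 : ∀ i : ZMod n, i + 1 ≠ i := fun i h => one_ne_zero (add_eq_left.1 h)
  have hle : ∀ i, a i ≤ 1 := by
    intro i
    rw [ha]
    split_ifs <;> norm_num
  have hap : a p = 0 := by simp [ha, hΔ]
  have haq : a q = 0 := by simp [ha, hΔ]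
  have hap' : a (p + 1) = 1 := by simp [ha, hΔ, hp1, Ne.symm hq₃]
  have haq' : a (q + 1) = 1 := by simp [ha, hΔ, hp1, hqp']
  have hp := hpos (p + 1)
  have hq := hpos (q + 1)
  rw [hγ, add_sub_cancel_right, hap, hap'] at hp
  rw [hγ, add_sub_cancel_right, haq, haq'] at hq
  have hp0 : det2 (u p) (u (p + 1 + 1)) ≤ 0 := by linarith [hle (p + 1 + 1)]
  have hq0 : det2 (u q) (u (q + 1 + 1)) ≤ 0 := by linarith [hle (q + 1 + 1)]
  by_cases hpq : p + 1 + 1 = q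
  · have e := hu.eq_neg_of_halfPlanes (Ne.symm hq₂) (Ne.symm hq₃) hqp' hp0 hq0
    rw [hpq, haq, e] at hp
    simp only [det2, Prod.fst_neg, Prod.snd_neg] at hp
    linarith
  · refine hu.not_halfPlanes_of_fifth_cone (r := p + 1 + 1) (Ne.symm hq₂) (Ne.symm hq₃) hqp'
      ?_ (hp1 _) hpq (fun h => hq₃ (add_right_cancel h).symm) hp0 hq0
    intro h
    rw [add_assoc, add_eq_left, one_add_one_eq_two] at h
    have h2 : ((2 : ℕ) : ZMod n) = 0 := by exact_mod_cast h
    have := Nat.le_of_dvd two_pos ((ZMod.natCast_eq_zero_iff 2 n).1 h2)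
    omega
end

section
/- Let n ≥ 3 and let u : ZMod n → ℤ² be the ray data of a complete smooth fan in ℝ² (each u_i primitive, det(u_i, u_{i+1}) = 1 for all i, the cones Cone(u_i, u_{i+1}) cover ℝ², and distinct such cones have disjoint interiors), set γ_i = det(u_{i-1}, u_{i+1}), and let a : ZMod n → ℤ. Let P = {m ∈ ℝ² : ⟨m, u_i⟩ ≥ -a_i for all i ∈ ZMod n} and for each i let P_i = P ∩ {m ∈ ℝ² : ⟨m, u_i⟩ = -a_i}. Assume P_i ≠ ∅ for every i ∈ ZMod n. Then for each i, the number of points of ℤ² lying on P_i, minus 1, equals |a_{i+1} + a_{i-1} - γ_i · a_i| (i.e., the lattice volume of the facet P_i is |a_{i+1} + a_{i-1} - γ_i a_i|). -/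
/-- The pairing `⟨m, u⟩ = m₁u₁ + m₂u₂` of `m ∈ ℝ²` with `u ∈ ℤ²`. -/
noncomputable def dotR (m : ℝ × ℝ) (u : ℤ × ℤ) : ℝ := m.1 * (u.1 : ℝ) + m.2 * (u.2 : ℝ)

/-- The lattice point `m` with `⟨m, u⟩ = -r` and `⟨m, v⟩ = -s`, when `det(u, v) = 1`. -/
def latticeVertex (u v : ℤ × ℤ) (r s : ℤ) : ℤ × ℤ :=
  (s * u.2 - r * v.2, r * v.1 - s * u.1)

theorem eq_det2_combination {u v : ℤ × ℤ} (h : det2 u v = 1) (w : ℤ × ℤ) :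
    w.1 = det2 w v * u.1 + det2 u w * v.1 ∧ w.2 = det2 w v * u.2 + det2 u w * v.2 := by
  simp only [det2] at *
  constructor
  · linear_combination (-w.1) * h
  · linear_combination (-w.2) * h

theorem dotR_eq_det2_combination {u v : ℤ × ℤ} (h : det2 u v = 1) (m : ℝ × ℝ) (w : ℤ × ℤ) :
    dotR m w = det2 w v * dotR m u + det2 u w * dotR m v := by
  obtain ⟨h₁, h₂⟩ := eq_det2_combination h w
  have h₁' : (w.1 : ℝ) = det2 w v * u.1 + det2 u w * v.1 := mod_cast h₁
  have h₂' : (w.2 : ℝ) = det2 w v * u.2 + det2 u w * v.2 := mod_cast h₂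
  simp only [dotR]
  linear_combination m.1 * h₁' + m.2 * h₂'

theorem dotR_toR2 (m u : ℤ × ℤ) : dotR (toR2 m) u = ((m.1 * u.1 + m.2 * u.2 : ℤ) : ℝ) := by
  simp [dotR, toR2]

/-- No ray of a smooth fan lies in the interior of one of its maximal cones. -/
theorem IsCompleteSmoothFan.det2_nonpos {n : ℕ} {u : ZMod n → ℤ × ℤ}
    (hu : IsCompleteSmoothFan u) {i j : ZMod n} (h : 0 < det2 (u j) (u (i + 1))) :
    det2 (u i) (u j) ≤ 0 := by
  by_contra! hβ
  have hij : i ≠ j := by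
    rintro rfl
    simp [det2, mul_comm] at hβ
  have hdisj := hu.disjoint_interiors i j hij
  obtain ⟨h₁, h₂⟩ := eq_det2_combination (hu.det_succ i) (u j)
  obtain ⟨h₃, h₄⟩ := eq_det2_combination (hu.det_succ i) (u (j + 1))
  set α := det2 (u j) (u (i + 1))
  set β := det2 (u i) (u j)
  set α' := det2 (u (j + 1)) (u (i + 1))
  set β' := det2 (u i) (u (j + 1))
  -- `N • u j + u (j + 1)` lies in both open cones once `N` is large.
  set N : ℤ := 1 + |α'| + |β'|
  have hN : 0 < N := by positivity
  have hα : 0 < N * α + α' := by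
    nlinarith [neg_abs_le α', abs_nonneg β']
  have hβ' : 0 < N * β + β' := by
    nlinarith [neg_abs_le β', abs_nonneg α']
  refine Set.eq_empty_iff_forall_notMem.mp hdisj
    ((N : ℝ) • toR2 (u j) + (1 : ℝ) • toR2 (u (j + 1)))
    ⟨⟨((N * α + α' : ℤ) : ℝ), ((N * β + β' : ℤ) : ℝ), mod_cast hα, mod_cast hβ', ?_⟩,
      ⟨N, 1, mod_cast hN, one_pos, rfl⟩⟩
  simp only [toR2, h₁, h₂, h₃, h₄]
  ext <;> simp <;> ring

/-- If the two facets adjacent to the cone `Cone(u i, u (i + 1))` are nonempty, the vertex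
determined by that cone satisfies every inequality defining the polytope. -/
theorem IsCompleteSmoothFan.vertex_le {n : ℕ} {u : ZMod n → ℤ × ℤ}
    (hu : IsCompleteSmoothFan u) {a : ZMod n → ℤ} {i : ZMod n} {p q : ℝ × ℝ}
    (hp : ∀ j, (-(a j) : ℝ) ≤ dotR p (u j)) (hpi : dotR p (u i) = -(a i))
    (hq : ∀ j, (-(a j) : ℝ) ≤ dotR q (u j)) (hqi : dotR q (u (i + 1)) = -(a (i + 1)))
    (j : ZMod n) :
    det2 (u j) (u (i + 1)) * a i + det2 (u i) (u j) * a (i + 1) ≤ a j := by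
  by_contra! hlt
  have hpj := hp j
  have hqj := hq j
  have hp₁ := hp (i + 1)
  have hq₀ := hq i
  rw [dotR_eq_det2_combination (hu.det_succ i)] at hpj hqj
  rw [hpi] at hpj
  rw [hqi] at hqj
  have hlt' : (a j : ℝ) < det2 (u j) (u (i + 1)) * a i + det2 (u i) (u j) * a (i + 1) :=
    mod_cast hlt
  have hβ : (0 : ℝ) < det2 (u i) (u j) := by
    by_contra! hle
    nlinarith
  have hα : (0 : ℝ) < det2 (u j) (u (i + 1)) := by
    by_contra! hle
    nlinarith
  exact absurd (hu.det2_nonpos (mod_cast hα)) (not_le.mpr (mod_cast hβ))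

/-- Let `P = {m ∈ ℝ² : ⟨m, u_i⟩ ≥ -a_i for all i}` be the polytope of the divisor
`Σ a_i D_i` and `P_i = P ∩ {⟨m, u_i⟩ = -a_i}` its facets. If every facet is
nonempty, then the number of lattice points on `P_i`, minus `1`, equals
`|a_{i+1} + a_{i-1} - γ_i a_i|` (the lattice volume of `P_i`). -/
theorem facet_lattice_volume {n : ℕ} (hn : 3 ≤ n)
    (u : ZMod n → ℤ × ℤ) (hu : IsCompleteSmoothFan u)
    (γ : ZMod n → ℤ) (hγ : ∀ i, γ i = det2 (u (i - 1)) (u (i + 1)))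
    (a : ZMod n → ℤ)
    (P : Set (ℝ × ℝ)) (hP : P = {m | ∀ i, (-(a i) : ℝ) ≤ dotR m (u i)})
    (Pf : ZMod n → Set (ℝ × ℝ))
    (hPf : ∀ i, Pf i = P ∩ {m | dotR m (u i) = (-(a i) : ℝ)})
    (hne : ∀ i, (Pf i).Nonempty) :
    ∀ i, ({m : ℤ × ℤ | toR2 m ∈ Pf i}.ncard : ℤ) - 1 =
      |a (i + 1) + a (i - 1) - γ i * a i| := by
  have hvertex : ∀ i j,
      det2 (u j) (u (i + 1)) * a i + det2 (u i) (u j) * a (i + 1) ≤ a j := by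
    intro i j
    obtain ⟨p, hp⟩ := hne i
    obtain ⟨q, hq⟩ := hne (i + 1)
    rw [hPf, hP] at hp hq
    exact hu.vertex_le hp.1 hp.2 hq.1 hq.2 j
  intro i
  have hmem : ∀ m : ℤ × ℤ, toR2 m ∈ Pf i ↔
      (∀ j, -(a j) ≤ m.1 * (u j).1 + m.2 * (u j).2) ∧
        m.1 * (u i).1 + m.2 * (u i).2 = -(a i) := by
    intro m
    simp only [hPf, hP, Set.mem_inter_iff, Set.mem_ofPred_eq, dotR_toR2]
    norm_cast
  have hdet := hu.det_succ i
  have hdet' : det2 (u (i - 1)) (u i) = 1 := by simpa using hu.det_succ (i - 1)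
  have hswap : det2 (u i) (u (i - 1)) = -1 := by
    simp only [det2] at hdet' ⊢
    linarith
  set c := a (i + 1) + a (i - 1) - γ i * a i with hc_def
  have hc : 0 ≤ c := by
    have h := hvertex i (i - 1)
    rw [hswap, ← hγ] at h
    linarith
  set v := latticeVertex (u i) (u (i + 1)) (a i) (a (i + 1)) with hv
  set f : ℤ → ℤ × ℤ := fun k => (v.1 - k * (u i).2, v.2 + k * (u i).1) with hf
  have hpair : ∀ k w, (f k).1 * w.1 + (f k).2 * w.2 =
      -(det2 w (u (i + 1)) * a i + det2 (u i) w * a (i + 1)) + k * det2 (u i) w := by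
    intro k w
    simp only [hf, hv, latticeVertex, det2]
    ring
  have hinj : Function.Injective f := by
    intro k l hkl
    have h₁ := hpair k (u (i + 1))
    have h₂ := hpair l (u (i + 1))
    rw [hkl] at h₁
    rw [hdet] at h₁ h₂
    linarith
  have hset : {m : ℤ × ℤ | toR2 m ∈ Pf i} = f '' (Finset.Icc 0 c : Finset ℤ) := by
    ext m
    simp only [Set.mem_ofPred_eq, hmem, Set.mem_image, Finset.coe_Icc, Set.mem_Icc]
    constructor
    · rintro ⟨hm, hmi⟩
      have hmf : f (m.1 * (u (i + 1)).1 + m.2 * (u (i + 1)).2 + a (i + 1)) = m := by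
        simp only [det2] at hdet
        simp only [hf, hv, latticeVertex]
        ext
        · linear_combination m.1 * hdet - (u (i + 1)).2 * hmi
        · linear_combination m.2 * hdet + (u (i + 1)).1 * hmi
      refine ⟨_, ⟨by linarith [hm (i + 1)], ?_⟩, hmf⟩
      have h := hm (i - 1)
      rw [← hmf, hpair, hswap, ← hγ] at h
      linarith
    · rintro ⟨k, ⟨hk₀, hk⟩, rfl⟩
      refine ⟨fun j => ?_, ?_⟩
      · rw [hpair]
        have h₁ := hvertex i j
        have h₂ := hvertex (i - 1) j
        rw [sub_add_cancel] at h₂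
        rcases le_or_gt 0 (det2 (u i) (u j)) with hd | hd
        · nlinarith
        · have hrel : det2 (u (i - 1)) (u j) + det2 (u (i + 1)) (u j) =
              γ i * det2 (u i) (u j) := by
            rw [hγ]
            obtain ⟨h₃, h₄⟩ := eq_det2_combination hdet (u (i - 1))
            rw [hswap] at h₃ h₄
            have : ∀ w, det2 (u (i - 1)) w + det2 (u (i + 1)) w =
                det2 (u (i - 1)) (u (i + 1)) * det2 (u i) w := by
              intro w
              generalize det2 (u (i - 1)) (u (i + 1)) = g at *
              simp only [det2]
              linear_combination w.2 * h₃ - w.1 * h₄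
            exact this _
          have hanti : ∀ x y, det2 x y = -det2 y x := by
            intro x y
            simp only [det2]
            ring
          rw [hanti (u j) (u (i + 1))]
          rw [hanti (u j) (u i)] at h₂
          have hkc := mul_le_mul_of_nonpos_right hk hd.le
          have hend : -(det2 (u (i + 1)) (u j)) * a i + det2 (u i) (u j) * a (i + 1) -
              c * det2 (u i) (u j) =
              -det2 (u i) (u j) * a (i - 1) + det2 (u (i - 1)) (u j) * a i := by
            rw [hc_def]
            linear_combination (-a i) * hrel
          linarith
      · rw [hpair, hdet]
        simp [det2, mul_comm]
  rw [hset, Set.ncard_image_of_injective _ hinj, Set.ncard_coe_finset, Int.card_Icc,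
    abs_of_nonneg hc, Int.toNat_of_nonneg (by linarith)]
  ring
end

section
/- Let u, v, w ∈ ℤ² with det(u, v) = 1 and det(v, w) = 1, let γ = det(u, w), and let a, b, c ∈ ℤ. Suppose m ∈ ℤ² satisfies ⟨m, u⟩ = -a and ⟨m, v⟩ = -b, and m' ∈ ℤ² satisfies ⟨m', v⟩ = -b and ⟨m', w⟩ = -c. Then the number of points of ℤ² lying on the closed segment from m to m' in ℝ² equals |a + c - γ·b| + 1. -/
/-- `⟨m, u⟩ = m₁u₁ + m₂u₂`, the dot product on `ℤ²`. -/
def dot2 (m u : ℤ × ℤ) : ℤ := m.1 * u.1 + m.2 * u.2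

/-- The closed segment `{t·x + (1-t)·y : t ∈ [0, 1]} ⊆ ℝ²` from `x` to `y`. -/
def seg (x y : ℝ × ℝ) : Set (ℝ × ℝ) :=
  {p | ∃ t : ℝ, 0 ≤ t ∧ t ≤ 1 ∧ p = t • x + (1 - t) • y}

/-- A lattice point lies on the segment between two lattice points of the line `⟨·, v⟩ = k` if and
only if it lies on that line and its pairing with `u` lies between those of the endpoints. -/
theorem toR2_mem_seg_iff {u v m m' p : ℤ × ℤ} {k : ℤ} (huv : det2 u v = 1)
    (hm : dot2 m v = k) (hm' : dot2 m' v = k) :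
    toR2 p ∈ seg (toR2 m) (toR2 m') ↔
      dot2 p v = k ∧ dot2 p u ∈ Finset.uIcc (dot2 m u) (dot2 m' u) := by
  have hmem : dot2 p u ∈ Finset.uIcc (dot2 m u) (dot2 m' u) ↔
      ((dot2 p u : ℤ) : ℝ) ∈ segment ℝ ((dot2 m u : ℤ) : ℝ) ((dot2 m' u : ℤ) : ℝ) := by
    rw [segment_eq_uIcc, Finset.mem_uIcc', Set.mem_uIcc]
    norm_cast
  rw [hmem]
  obtain ⟨u1, u2⟩ := u
  obtain ⟨v1, v2⟩ := v
  obtain ⟨m1, m2⟩ := m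
  obtain ⟨n1, n2⟩ := m'
  obtain ⟨p1, p2⟩ := p
  simp only [det2, dot2, toR2, seg, segment, Set.mem_ofPred_eq, Prod.smul_mk, Prod.mk_add_mk,
    Prod.mk.injEq, smul_eq_mul] at *
  have huv' : (u1 * v2 - u2 * v1 : ℝ) = 1 := mod_cast huv
  have hm₁ : (m1 * v1 + m2 * v2 : ℝ) = k := mod_cast hm
  have hm₂ : (n1 * v1 + n2 * v2 : ℝ) = k := mod_cast hm'
  push_cast
  constructor
  · rintro ⟨t, ht0, ht1, h1, h2⟩
    refine ⟨?_, t, 1 - t, ht0, by linarith, by ring, by rw [h1, h2]; ring⟩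
    have h : (p1 * v1 + p2 * v2 : ℝ) = k := by
      rw [h1, h2]
      linear_combination t * hm₁ + (1 - t) * hm₂
    exact_mod_cast h
  · rintro ⟨hp, t, s, ht, hs, hts, h⟩
    have hp' : (p1 * v1 + p2 * v2 : ℝ) = k := mod_cast hp
    obtain rfl : s = 1 - t := by linarith
    have hv : (t * (m1 * v1 + m2 * v2) + (1 - t) * (n1 * v1 + n2 * v2) : ℝ) =
        p1 * v1 + p2 * v2 := by rw [hm₁, hm₂, hp']; ring
    refine ⟨t, ht, by linarith, ?_, ?_⟩
    · linear_combination u2 * hv - v2 * h - (p1 - t * m1 - (1 - t) * n1) * huv'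
    · linear_combination v1 * h - u1 * hv - (p2 - t * m2 - (1 - t) * n2) * huv'

/-- The lattice points of the line `⟨·, v⟩ = k` are parametrized by their pairing with `u`. -/
theorem ncard_dot2_eq_and_mem {u v : ℤ × ℤ} (huv : det2 u v = 1) (k : ℤ) (s : Finset ℤ) :
    {p : ℤ × ℤ | dot2 p v = k ∧ dot2 p u ∈ s}.ncard = s.card := by
  rw [← Set.ncard_coe_finset s]
  refine Set.ncard_congr (fun p _ => dot2 p u) (fun p hp => hp.2) ?_ ?_
  · rintro ⟨p1, p2⟩ ⟨q1, q2⟩ ⟨hp, -⟩ ⟨hq, -⟩ h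
    simp only [det2, dot2] at huv hp hq h
    ext
    · linear_combination v.2 * h - u.2 * (hp - hq) - (p1 - q1) * huv
    · linear_combination u.1 * (hp - hq) - v.1 * h - (p2 - q2) * huv
  · intro x hx
    have hxu : dot2 (x * v.2 - k * u.2, k * u.1 - x * v.1) u = x := by
      simp only [det2, dot2] at huv ⊢
      linear_combination x * huv
    refine ⟨(x * v.2 - k * u.2, k * u.1 - x * v.1), ⟨?_, by rwa [hxu]⟩, hxu⟩
    simp only [det2, dot2] at huv ⊢
    linear_combination k * huv

/-- For three consecutive rays `u, v, w` of a smooth fan (`det(u,v) = det(v,w) = 1`,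
`γ = det(u,w)`) and divisor coefficients `a, b, c`, if `m` and `m'` are the two
vertices adjacent to the facet perpendicular to `v` (`⟨m,u⟩ = -a`, `⟨m,v⟩ = -b`,
`⟨m',v⟩ = -b`, `⟨m',w⟩ = -c`), then the number of lattice points on the closed
segment from `m` to `m'` equals `|a + c - γ·b| + 1`. -/
theorem lattice_points_on_facet (u v w : ℤ × ℤ)
    (huv : det2 u v = 1) (hvw : det2 v w = 1)
    (γ : ℤ) (hγ : γ = det2 u w) (a b c : ℤ) (m m' : ℤ × ℤ)
    (hmu : dot2 m u = -a) (hmv : dot2 m v = -b)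
    (hm'v : dot2 m' v = -b) (hm'w : dot2 m' w = -c) :
    ({p : ℤ × ℤ | toR2 p ∈ seg (toR2 m) (toR2 m')}.ncard : ℤ) = |a + c - γ * b| + 1 := by
  have hm'u : dot2 m' u = c - γ * b := by
    subst hγ
    simp only [det2, dot2] at *
    linear_combination (-1 : ℤ) * hm'w + (u.1 * w.2 - u.2 * w.1) * hm'v
      - (m'.1 * w.1 + m'.2 * w.2) * huv - (m'.1 * u.1 + m'.2 * u.2) * hvw
  simp_rw [toR2_mem_seg_iff huv hmv hm'v]
  rw [ncard_dot2_eq_and_mem huv, Int.card_uIcc, hmu, hm'u]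
  push_cast
  congr 2
  ring
end
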